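/- Let d ≥ 3 and let X = (Fin d → ℝ) and Y = (Fin d → ℝ) carry 1-unconditional, strictly monotone norms, both one-p-convex for some 2 < p < ∞, and let U : X → Y be a surjective linear isometry. Then for every index k the support of U e_k contains at most two indices, i.e. there exist indices i, j and reals κ_i, κ_j with U e_k = κ_i f_i + κ_j f_j. Moreover, if i ≠ j and both κ_i ≠ 0 and κ_j ≠ 0, then there exists a unique index l ≠ k such that U e_l lies in the span of f_i and f_j (i.e. U e_l = λ_i f_i + λ_j f_j for some reals λ_i, λ_j). -/

import Mathlib

lemma scalar_ineq (p : ℝ) (hp : 2 < p) (a b : ℝ) :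
    (a ^ 2 + b ^ 2) ^ (p / 2) ≤ |a + b| ^ p / 2 + |a - b| ^ p / 2 := by
  have hc := (convexOn_rpow (p := p / 2) (by linarith)).2
    (Set.mem_Ici.2 (sq_nonneg (a + b))) (Set.mem_Ici.2 (sq_nonneg (a - b)))
    (show (0 : ℝ) ≤ 1 / 2 by norm_num) (show (0 : ℝ) ≤ 1 / 2 by norm_num) (by norm_num)
  have e : ∀ x : ℝ, (x ^ 2) ^ (p / 2) = |x| ^ p := by
    intro x
    rw [← sq_abs, ← Real.rpow_natCast, ← Real.rpow_mul (abs_nonneg _)]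
    congr 1
    push_cast; ring
  simp only [smul_eq_mul, e] at hc
  have h1 : 1 / 2 * (a + b) ^ 2 + 1 / 2 * (a - b) ^ 2 = a ^ 2 + b ^ 2 := by ring
  rw [h1] at hc
  linarith

lemma small_contra (p K V : ℝ) (hp : 2 < p) (hK : 0 < K)
    (h : ∀ s : ℝ, 0 < s → s ≤ 1 → K * s ^ 2 ≤ s ^ p * V) : False := by
  have ht : Filter.Tendsto (fun s : ℝ => s ^ (p - 2) * V) (nhdsWithin 0 (Set.Ioi 0))
      (nhds 0) := by
    have h1 : ContinuousAt (fun s : ℝ => s ^ (p - 2) * V) 0 :=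
      (Real.continuousAt_rpow_const 0 (p - 2) (Or.inr (by linarith))).mul continuousAt_const
    have h2 := h1.tendsto
    simp only [Real.zero_rpow (show p - 2 ≠ 0 by linarith), zero_mul] at h2
    exact h2.mono_left nhdsWithin_le_nhds
  have h3 : ∀ᶠ s : ℝ in nhdsWithin 0 (Set.Ioi 0), s ^ (p - 2) * V < K :=
    ht.eventually_lt_const hK
  have h4 : ∀ᶠ s : ℝ in nhdsWithin 0 (Set.Ioi 0), s ∈ Set.Ioc (0 : ℝ) 1 :=
    Ioc_mem_nhdsGT one_pos
  obtain ⟨s, hs1, hs2⟩ := (h3.and h4).exists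
  have h5 := h s hs2.1 hs2.2
  have h6 : s ^ p = s ^ (p - 2) * s ^ 2 := by
    rw [← Real.rpow_natCast s 2, ← Real.rpow_add hs2.1]; congr 1; push_cast; ring
  rw [h6] at h5
  have := pow_pos hs2.1 2
  nlinarith

lemma pw_disj {d : ℕ} (N : (Fin d → ℝ) → ℝ)
    (hadd : ∀ x y, N (x + y) ≤ N x + N y)
    (hsmul : ∀ (c : ℝ) (x), N (c • x) = |c| * N x)
    (huncond : ∀ x y : Fin d → ℝ, (∀ i, |x i| ≤ |y i|) → N x ≤ N y)
    (hstrict : ∀ x y : Fin d → ℝ, (∀ i, |x i| ≤ |y i|) →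
      (∃ i, |x i| < |y i|) → N x < N y)
    (p : ℝ) (hp : 2 < p)
    (hpconv : ∀ (m : ℕ) (xs : Fin m → (Fin d → ℝ)),
      N (fun i => (∑ j, |xs j i| ^ p) ^ (1 / p)) ≤
        (∑ j, N (xs j) ^ p) ^ (1 / p))
    (y v : Fin d → ℝ) (V : ℝ)
    (hsym : ∀ s : ℝ, N (y - s • v) = N (y + s • v))
    (hup : ∀ s : ℝ, 0 < s → N (y + s • v) ^ p ≤ N y ^ p + s ^ p * V)
    (i : Fin d) (hy : y i ≠ 0) (hv : v i ≠ 0) : False := by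
  have hp0 : 0 < p := by linarith
  have N0 : N 0 = 0 := by simpa using hsmul 0 0
  have hnn : ∀ x, 0 ≤ N x := fun x => by
    rw [← N0]; exact huncond 0 x (fun i => by simp)
  set y0 := Function.update y i 0 with hy0
  have hlt : N y0 < N y := by
    apply hstrict
    · intro m
      by_cases h : m = i
      · subst h; simp [hy0]
      · simp [hy0, h]
    · exact ⟨i, by simp [hy0, hy]⟩
  have hNy : 0 < N y := lt_of_le_of_lt (hnn _) hlt
  set q := (v i) ^ 2 / (y i) ^ 2 with hq
  have hq0 : 0 < q := by positivity
  set δ := min 1 (q / 3) with hδ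
  have hδ0 : 0 < δ := by positivity
  have hδ1 : δ ≤ 1 := min_le_left _ _
  have hδq : δ ≤ q / 3 := min_le_right _ _
  have hvq : (v i) ^ 2 = q * (y i) ^ 2 := by rw [hq]; field_simp
  apply small_contra p (p * N y ^ (p - 1) * (δ * (N y - N y0))) V hp
  · have : 0 < N y ^ (p - 1) := Real.rpow_pos_of_pos hNy _
    have : 0 < N y - N y0 := by linarith
    positivity
  intro s hs hs1
  -- the quadratic mean vector
  set z : Fin d → ℝ := fun m => ((y m) ^ 2 + (s * v m) ^ 2) ^ (1 / 2 : ℝ) with hz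
  have hzub : N z ^ p ≤ N y ^ p + s ^ p * V := by
    refine le_trans ?_ (hup s hs)
    set c : ℝ := (1 / 2 : ℝ) ^ (1 / p) with hc
    have hc0 : 0 < c := by positivity
    have hcp : c ^ p = 1 / 2 := by
      rw [hc, ← Real.rpow_mul (by norm_num), one_div_mul_cancel hp0.ne', Real.rpow_one]
    have h1 := hpconv 2 ![c • (y + s • v), c • (y - s • v)]
    simp only [Fin.sum_univ_two, Matrix.cons_val_zero, Matrix.cons_val_one, hsmul, hsym,
      abs_of_pos hc0, Pi.smul_apply, Pi.add_apply, Pi.sub_apply, smul_eq_mul, abs_mul] at h1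
    simp only [Real.mul_rpow hc0.le (hnn _), Real.mul_rpow hc0.le (abs_nonneg _), hcp] at h1
    have h2 : 1 / 2 * N (y + s • v) ^ p + 1 / 2 * N (y + s • v) ^ p = N (y + s • v) ^ p := by
      ring
    rw [h2, ← Real.rpow_mul (hnn _), mul_one_div_cancel hp0.ne', Real.rpow_one] at h1
    refine Real.rpow_le_rpow (hnn _) (le_trans ?_ h1) hp0.le
    apply huncond
    intro m
    have h3 : 0 ≤ (y m) ^ 2 + (s * v m) ^ 2 := by positivity
    have h4 := scalar_ineq p hp (y m) (s * v m)
    rw [hz, abs_of_nonneg (by positivity), abs_of_nonneg (by positivity)]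
    have h5 : ((y m) ^ 2 + (s * v m) ^ 2) ^ (1 / 2 : ℝ)
        = (((y m) ^ 2 + (s * v m) ^ 2) ^ (p / 2)) ^ (1 / p) := by
      rw [← Real.rpow_mul h3]; congr 1; field_simp
    simp only [h5]
    apply Real.rpow_le_rpow (by positivity) _ (by positivity)
    linarith
  set r := δ * s ^ 2 with hr
  have hr0 : 0 < r := by positivity
  have hr1 : r ≤ 1 := by
    have : s ^ 2 ≤ 1 := by nlinarith
    nlinarith
  set yr := y + r • (y - y0) with hyr
  have hyrN : N y + r * (N y - N y0) ≤ N yr := by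
    have h1 := hadd yr (r • y0)
    have h2 : yr + r • y0 = (1 + r) • y := by
      ext m; simp [hyr]; ring
    rw [h2, hsmul, hsmul, abs_of_pos hr0, abs_of_pos (by linarith)] at h1
    linarith
  have hyrz : N yr ≤ N z := by
    apply huncond
    intro m
    refine le_trans ?_ (le_abs_self _)
    simp only [hz, ← Real.sqrt_eq_rpow]
    apply Real.abs_le_sqrt
    by_cases h : m = i
    · subst h
      have : yr m = (1 + r) * y m := by simp [hyr, hy0]; ring
      rw [this, mul_pow, mul_pow, hvq]
      have h6 : (1 + r) ^ 2 ≤ 1 + s ^ 2 * q := by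
        have : s ^ 2 * δ ≤ s ^ 2 * (q / 3) := mul_le_mul_of_nonneg_left hδq (by positivity)
        nlinarith
      nlinarith [mul_le_mul_of_nonneg_right h6 (sq_nonneg (y m))]
    · have : yr m = y m := by simp [hyr, hy0, h]
      rw [this]; nlinarith [sq_nonneg (s * v m)]
  have hD : 0 < N y - N y0 := by linarith
  have hbern : N y ^ p + p * N y ^ (p - 1) * (r * (N y - N y0))
      ≤ (N y + r * (N y - N y0)) ^ p := by
    set t := r * (N y - N y0) / N y with ht
    have ht0 : 0 ≤ t := by positivity
    have h1 := one_add_mul_self_le_rpow_one_add (s := t) (by linarith) (p := p) (by linarith)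
    have h2 : N y + r * (N y - N y0) = N y * (1 + t) := by rw [ht]; field_simp
    have h3 : N y ^ p = N y ^ (p - 1) * N y := by
      rw [← Real.rpow_add_one hNy.ne']; congr 1; ring
    have h4 : r * (N y - N y0) = N y * t := by rw [ht]; field_simp
    rw [h2, Real.mul_rpow hNy.le (by linarith), h4]
    have h5 := mul_le_mul_of_nonneg_left h1 (Real.rpow_nonneg hNy.le p)
    refine le_trans (le_of_eq ?_) h5
    rw [h3]; ring
  have hfin := Real.rpow_le_rpow (by positivity) (hyrN.trans hyrz) hp0.le
  have : p * N y ^ (p - 1) * (δ * (N y - N y0)) * s ^ 2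
      = p * N y ^ (p - 1) * (r * (N y - N y0)) := by rw [hr]; ring
  rw [this]
  linarith



theorem stmt16 (d : ℕ) (hd : 3 ≤ d)
    (NX NY : (Fin d → ℝ) → ℝ)
    (hNX_add : ∀ x y, NX (x + y) ≤ NX x + NX y)
    (hNX_smul : ∀ (c : ℝ) (x), NX (c • x) = |c| * NX x)
    (hNX_def : ∀ x, NX x = 0 → x = 0)
    (hNY_add : ∀ x y, NY (x + y) ≤ NY x + NY y)
    (hNY_smul : ∀ (c : ℝ) (x), NY (c • x) = |c| * NY x)
    (hNY_def : ∀ x, NY x = 0 → x = 0)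
    (hNX_uncond : ∀ x y : Fin d → ℝ, (∀ i, |x i| ≤ |y i|) → NX x ≤ NX y)
    (hNY_uncond : ∀ x y : Fin d → ℝ, (∀ i, |x i| ≤ |y i|) → NY x ≤ NY y)
    (hNX_strict : ∀ x y : Fin d → ℝ, (∀ i, |x i| ≤ |y i|) →
      (∃ i, |x i| < |y i|) → NX x < NX y)
    (hNY_strict : ∀ x y : Fin d → ℝ, (∀ i, |x i| ≤ |y i|) →
      (∃ i, |x i| < |y i|) → NY x < NY y)
    (p : ℝ) (hp : 2 < p)
    (hNX_pconv : ∀ (m : ℕ) (xs : Fin m → (Fin d → ℝ)),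
      NX (fun i => (∑ j, |xs j i| ^ p) ^ (1 / p)) ≤
        (∑ j, NX (xs j) ^ p) ^ (1 / p))
    (hNY_pconv : ∀ (m : ℕ) (xs : Fin m → (Fin d → ℝ)),
      NY (fun i => (∑ j, |xs j i| ^ p) ^ (1 / p)) ≤
        (∑ j, NY (xs j) ^ p) ^ (1 / p))
    (U : (Fin d → ℝ) →ₗ[ℝ] (Fin d → ℝ))
    (hU_surj : Function.Surjective U)
    (hU_isom : ∀ x, NY (U x) = NX x) :
    ∀ k : Fin d, ∃ (i j : Fin d) (κi κj : ℝ),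
      U ((Pi.single k 1 : Fin d → ℝ)) = κi • (Pi.single i 1 : Fin d → ℝ) + κj • (Pi.single j 1 : Fin d → ℝ) ∧
      (i ≠ j → κi ≠ 0 → κj ≠ 0 →
        ∃ l : Fin d,
          (l ≠ k ∧ ∃ li lj : ℝ,
            U ((Pi.single l 1 : Fin d → ℝ)) = li • (Pi.single i 1 : Fin d → ℝ) + lj • (Pi.single j 1 : Fin d → ℝ)) ∧
          (∀ l' : Fin d, l' ≠ k →
            (∃ li lj : ℝ,
              U ((Pi.single l' 1 : Fin d → ℝ)) = li • (Pi.single i 1 : Fin d → ℝ) + lj • (Pi.single j 1 : Fin d → ℝ)) →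
            l' = l)) := by
  have hp0 : 0 < p := by linarith
  have N0 : NX 0 = 0 := by simpa using hNX_smul 0 0
  have hnn : ∀ x, 0 ≤ NX x := fun x => by
    rw [← N0]; exact hNX_uncond 0 x (fun i => by simp)
  have disj : ∀ k l : Fin d, l ≠ k → ∀ i : Fin d,
      U (Pi.single l 1) i ≠ 0 → U (Pi.single k 1) i ≠ 0 → False := by
    intro k l hlk i h1 h2
    have e1 : ∀ s : ℝ, U (Pi.single l 1) + s • U (Pi.single k 1)
        = U (Pi.single l 1 + s • Pi.single k 1) := fun s => by simp only [map_add, map_smul]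
    have e2 : ∀ s : ℝ, U (Pi.single l 1) - s • U (Pi.single k 1)
        = U (Pi.single l 1 - s • Pi.single k 1) := fun s => by simp only [map_sub, map_smul]
    have cs : ∀ m : Fin d, ((Pi.single l 1 : Fin d → ℝ) m = 0) ∨
        ((Pi.single k 1 : Fin d → ℝ) m = 0) := by
      intro m
      by_cases hm : m = l
      · right; subst hm; simp [hlk]
      · left; simp [hm]
    refine pw_disj NY hNY_add hNY_smul hNY_uncond hNY_strict p hp hNY_pconv
      (U (Pi.single l 1)) (U (Pi.single k 1)) (NX (Pi.single k 1) ^ p) ?_ ?_ i h1 h2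
    · intro s
      rw [e1, e2, hU_isom, hU_isom]
      apply le_antisymm <;> apply hNX_uncond <;> intro m <;>
        simp only [Pi.add_apply, Pi.sub_apply, Pi.smul_apply] <;>
        rcases cs m with h | h <;> rw [h] <;> simp
    · intro s hs
      rw [e1, hU_isom, hU_isom]
      have h3 := hNX_pconv 2 ![Pi.single l 1, s • Pi.single k 1]
      simp only [Fin.sum_univ_two, Matrix.cons_val_zero, Matrix.cons_val_one, hNX_smul,
        abs_of_pos hs] at h3
      have h4 : NX (Pi.single l 1 + s • Pi.single k 1) ≤
          NX (fun m => (|(Pi.single l 1 : Fin d → ℝ) m| ^ p +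
            |(s • (Pi.single k 1 : Fin d → ℝ)) m| ^ p) ^ (1 / p)) := by
        apply hNX_uncond
        intro m
        rw [abs_of_nonneg (a := (_ : ℝ) ^ (1 / p)) (by positivity)]
        simp only [Pi.add_apply, Pi.smul_apply]
        rcases cs m with h | h <;> rw [h] <;>
          simp only [smul_zero, abs_zero, Real.zero_rpow hp0.ne', zero_add, add_zero] <;>
          rw [← Real.rpow_mul (abs_nonneg _), mul_one_div_cancel hp0.ne', Real.rpow_one]
      have h5 := Real.rpow_le_rpow (hnn _) (h4.trans h3) hp0.le
      have hA := hnn (Pi.single l 1)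
      have hB := hnn (Pi.single k 1)
      rw [← Real.rpow_mul (by positivity), one_div_mul_cancel hp0.ne', Real.rpow_one,
        Real.mul_rpow hs.le hB] at h5
      exact h5
  -- the support of each `U e_k` has at most one element
  have row : ∀ k i : Fin d, U (Pi.single k 1) i ≠ 0 → ∀ x, U x i = x k * U (Pi.single k 1) i := by
    intro k i hk x
    conv_lhs => rw [pi_eq_sum_univ' x, map_sum]
    rw [Finset.sum_apply, Finset.sum_eq_single k]
    · simp
    · intro l _ hl
      rw [map_smul, Pi.smul_apply]
      have : U (Pi.single l 1) i = 0 := by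
        by_contra h
        exact disj k l hl i h hk
      rw [this, smul_zero]
    · simp
  intro k
  have hsupp : ∃ i, ∀ j, j ≠ i → U (Pi.single k 1) j = 0 := by
    by_cases h : ∃ i, U (Pi.single k 1) i ≠ 0
    · obtain ⟨i, hi⟩ := h
      refine ⟨i, fun j hj => ?_⟩
      by_contra hne
      obtain ⟨x, hx⟩ := hU_surj (Pi.single i 1)
      have h1 := row k i hi x
      have h2 := row k j hne x
      rw [hx] at h1 h2
      simp [hj] at h1 h2
      rcases h2 with h2 | h2
      · simp [h2] at h1
      · exact hne h2
    · push Not at h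
      exact ⟨k, fun j _ => h j⟩
  obtain ⟨i, hi⟩ := hsupp
  refine ⟨i, i, U (Pi.single k 1) i, 0, ?_, fun h => absurd rfl h⟩
  ext j
  by_cases hj : j = i
  · subst hj; simp
  · simp [hi j hj, hj]
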